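/- arXiv:1606.01364 — 3 statements merged into one kernel-verified Lean document; each statement's English description precedes it below -/
import Mathlib

section
/- (Theorem 1, optimality.) Let ε > 0 and set δ = √(ε²/(1+ε²)) (so 0 < δ < 1). Then A_ε(0) = 0 and, for every l ∈ ℕ, A_ε(l+1) − A_ε(l) = (1 + 2δ²·A_ε(l))/(1 − δ²); i.e., A_ε satisfies the recursive characterization of the unique optimal estimation function with maximal coefficient of variation δ of the hitting time. -/
/-- The optimal estimation function `A_ε(l) = ((1+2ε²)^l − 1)(1+ε²)/(2ε²)`. -/
noncomputable def A (ε : ℝ) (l : ℕ) : ℝ :=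
  ((1 + 2 * ε ^ 2) ^ l - 1) / (2 * ε ^ 2) * (1 + ε ^ 2)

/-- Theorem 1, optimality: with `δ = √(ε²/(1+ε²))` we have
`0 < δ < 1`, `A_ε(0) = 0`, and `A_ε(l+1) − A_ε(l) = (1 + 2δ²·A_ε(l))/(1 − δ²)`
for every `l`, i.e. `A_ε` satisfies the recursive characterization of the
unique optimal estimation function with maximal CV `δ` of the hitting time. -/
theorem optimal_estimation_optimality (ε : ℝ) (hε : ε > 0)
    (δ : ℝ) (hδ : δ = Real.sqrt (ε ^ 2 / (1 + ε ^ 2))) :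
    0 < δ ∧ δ < 1 ∧ A ε 0 = 0 ∧
    (∀ l : ℕ, A ε (l + 1) - A ε l = (1 + 2 * δ ^ 2 * A ε l) / (1 - δ ^ 2)) := by
  have hsq : δ ^ 2 = ε ^ 2 / (1 + ε ^ 2) := by
    rw [hδ, Real.sq_sqrt (by positivity)]
  have h_one_sub : 1 - δ ^ 2 = 1 / (1 + ε ^ 2) := by
    rw [hsq]
    field_simp
    ring
  refine ⟨?_, ?_, by simp [A], fun l => ?_⟩
  · rw [hδ]
    positivity
  · have h_pos : 0 < 1 - δ ^ 2 := by
      rw [h_one_sub]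
      positivity
    nlinarith
  · rw [h_one_sub, hsq, A, A, pow_succ]
    field_simp
    ring
end

section
/- (Unbiasedness.) For every ε > 0 and every n ∈ ℕ, the symbol distribution satisfies Σ_{l ∈ ℕ} Q_l(n) = 1 and Σ_{l ∈ ℕ} Q_l(n)·A_ε(l) = n; i.e., the estimator is unbiased: its expected estimation value after n packet arrivals equals n. -/
/-- `D_ε(l) = A_ε(l+1) − A_ε(l)`. -/
noncomputable def D (ε : ℝ) (l : ℕ) : ℝ := A ε (l + 1) - A ε l

/-- `Q ε n l` is the probability `Q_l(n)` that the counter's symbol equals `l`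
after `n` packet arrivals, for the process that starts at symbol `0` and on
each arrival increments the current symbol `l` to `l+1` with probability
`1/D_ε(l)`. -/
noncomputable def Q (ε : ℝ) : ℕ → ℕ → ℝ
  | 0, 0 => 1
  | 0, _ + 1 => 0
  | n + 1, 0 => Q ε n 0 * (1 - 1 / D ε 0)
  | n + 1, l + 1 => Q ε n (l + 1) * (1 - 1 / D ε (l + 1)) + Q ε n l / D ε l

theorem D_pos {ε : ℝ} (hε : 0 < ε) (l : ℕ) : 0 < D ε l := by
  have h : D ε l = (1 + 2 * ε ^ 2) ^ l * (1 + ε ^ 2) := by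
    unfold D A
    field_simp
    ring
  rw [h]
  positivity

theorem Q_eq_zero_of_lt (ε : ℝ) {n l : ℕ} (h : n < l) : Q ε n l = 0 := by
  induction n generalizing l with
  | zero =>
    obtain ⟨l, rfl⟩ := Nat.exists_eq_succ_of_ne_zero h.ne'
    simp [Q]
  | succ n ih =>
    obtain ⟨l, rfl⟩ := Nat.exists_eq_succ_of_ne_zero (Nat.ne_zero_of_lt h)
    simp [Q, ih (show n < l + 1 by omega), ih (show n < l by omega)]

/-- The expectation of `f` after one more arrival is the expectation of the
one-step transition operator applied to `f`. -/
theorem sum_Q_succ_mul (ε : ℝ) (n : ℕ) (f : ℕ → ℝ) :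
    ∑ l ∈ Finset.range (n + 2), Q ε (n + 1) l * f l =
      ∑ l ∈ Finset.range (n + 1), Q ε n l * (f l + (f (l + 1) - f l) / D ε l) := by
  have hstay : ∑ l ∈ Finset.range (n + 1), Q ε n l * (1 - 1 / D ε l) * f l =
      ∑ l ∈ Finset.range (n + 1), Q ε n (l + 1) * (1 - 1 / D ε (l + 1)) * f (l + 1) +
        Q ε n 0 * (1 - 1 / D ε 0) * f 0 := by
    rw [← Finset.sum_range_succ' (fun l => Q ε n l * (1 - 1 / D ε l) * f l),
      Finset.sum_range_succ _ (n + 1), Q_eq_zero_of_lt ε (Nat.lt_succ_self n)]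
    simp
  have hsplit : ∑ l ∈ Finset.range (n + 1), Q ε n l * (f l + (f (l + 1) - f l) / D ε l) =
      ∑ l ∈ Finset.range (n + 1), Q ε n l * (1 - 1 / D ε l) * f l +
        ∑ l ∈ Finset.range (n + 1), Q ε n l / D ε l * f (l + 1) := by
    rw [← Finset.sum_add_distrib]
    exact Finset.sum_congr rfl fun l _ => by ring
  rw [hsplit, hstay, Finset.sum_range_succ']
  simp only [Q, add_mul, Finset.sum_add_distrib]
  ring

theorem sum_Q (ε : ℝ) (n : ℕ) : ∑ l ∈ Finset.range (n + 1), Q ε n l = 1 := by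
  induction n with
  | zero => simp [Q]
  | succ n ih => simpa [ih] using sum_Q_succ_mul ε n fun _ => 1

theorem sum_Q_mul_A {ε : ℝ} (hε : 0 < ε) (n : ℕ) :
    ∑ l ∈ Finset.range (n + 1), Q ε n l * A ε l = n := by
  induction n with
  | zero => simp [Q, A]
  | succ n ih =>
    have hstep (l : ℕ) : (A ε (l + 1) - A ε l) / D ε l = 1 := div_self (D_pos hε l).ne'
    rw [sum_Q_succ_mul]
    simp only [hstep, mul_add, mul_one, Finset.sum_add_distrib, ih, sum_Q]
    push_cast
    rfl

/-- Unbiasedness: for every `ε > 0` and `n`, the symbol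
distribution sums to one and the estimator is unbiased:
`Σ_l Q_l(n) = 1` and `Σ_l Q_l(n)·A_ε(l) = n`. -/
theorem estimator_unbiased (ε : ℝ) (hε : ε > 0) (n : ℕ) :
    (∑' l : ℕ, Q ε n l) = 1 ∧ (∑' l : ℕ, Q ε n l * A ε l) = n := by
  have hzero (l : ℕ) (hl : l ∉ Finset.range (n + 1)) : Q ε n l = 0 :=
    Q_eq_zero_of_lt ε (by rw [Finset.mem_range] at hl; omega)
  constructor
  · rw [tsum_eq_sum hzero, sum_Q]
  · rw [tsum_eq_sum (s := Finset.range (n + 1)) fun l hl => by rw [hzero l hl, zero_mul],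
      sum_Q_mul_A hε]
end

section
/- (Monotonicity and convexity of the counting capacity.) For every integer k ≥ 1, the function m(s) = ((1 + 2s)^k − 1)(1 + s)/(2s) (the counting capacity A_ε(k) written as a function of s = ε²) is strictly increasing and convex on (0, ∞). -/
theorem one_add_two_mul_pow_sub_one_mul_div (k : ℕ) {s : ℝ} (hs : s ≠ 0) :
    ((1 + 2 * s) ^ k - 1) * (1 + s) / (2 * s) =
      (∑ i ∈ Finset.range k, (1 + 2 * s) ^ i) * (1 + s) := by
  have h := geom_sum_mul (1 + 2 * s) k
  rw [← h]
  field_simp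
  ring

theorem monotoneOn_geom_sum_one_add_two_mul (k : ℕ) :
    MonotoneOn (fun s : ℝ => ∑ i ∈ Finset.range k, (1 + 2 * s) ^ i) (Set.Ioi 0) := by
  intro a ha b _ hab
  have ha' : 0 < a := ha
  dsimp only
  gcongr

theorem convexOn_geom_sum_one_add_two_mul (k : ℕ) :
    ConvexOn ℝ (Set.Ioi 0) (fun s : ℝ => ∑ i ∈ Finset.range k, (1 + 2 * s) ^ i) := by
  induction k with
  | zero => simpa using convexOn_const (0 : ℝ) (convex_Ioi (0 : ℝ))
  | succ k ih =>
    simp only [Finset.sum_range_succ]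
    refine ih.add (ConvexOn.pow ⟨convex_Ioi 0, fun x _ y _ a b _ _ hab => ?_⟩ ?_ k)
    · simp only [smul_eq_mul]
      linear_combination (-1 : ℝ) * hab
    · intro s hs
      have hs' : 0 < s := hs
      positivity

/-- Monotonicity and convexity of the counting capacity: for
every integer `k ≥ 1`, the function `m(s) = ((1+2s)^k − 1)(1+s)/(2s)` (the
counting capacity `A_ε(k)` as a function of `s = ε²`) is strictly increasing
and convex on `(0, ∞)`. -/
theorem capacity_strictMono_convex (k : ℕ) (hk : 1 ≤ k) :
    StrictMonoOn (fun s : ℝ => ((1 + 2 * s) ^ k - 1) * (1 + s) / (2 * s))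
        (Set.Ioi 0) ∧
    ConvexOn ℝ (Set.Ioi 0)
        (fun s : ℝ => ((1 + 2 * s) ^ k - 1) * (1 + s) / (2 * s)) := by
  have heq : Set.EqOn (fun s : ℝ => (∑ i ∈ Finset.range k, (1 + 2 * s) ^ i) * (1 + s))
      (fun s : ℝ => ((1 + 2 * s) ^ k - 1) * (1 + s) / (2 * s)) (Set.Ioi 0) :=
    fun s hs => (one_add_two_mul_pow_sub_one_mul_div k (ne_of_gt hs)).symm
  have hpos : ∀ s : ℝ, 0 < s → 0 < ∑ i ∈ Finset.range k, (1 + 2 * s) ^ i := fun s hs =>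
    Finset.sum_pos (fun i _ => by positivity) ⟨0, Finset.mem_range.2 hk⟩
  have hmono := monotoneOn_geom_sum_one_add_two_mul k
  refine ⟨StrictMonoOn.congr (fun a ha b hb hab => ?_) heq, ConvexOn.congr ?_ heq⟩
  · have ha' : 0 < a := ha
    exact mul_lt_mul' (hmono ha hb hab.le) (by linarith) (by linarith) (hpos b hb)
  · refine (convexOn_geom_sum_one_add_two_mul k).mul
      ⟨convex_Ioi 0, fun x _ y _ a b _ _ hab => ?_⟩ (fun s hs => (hpos s hs).le) ?_ ?_
    · simp only [smul_eq_mul]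
      linear_combination (-1 : ℝ) * hab
    · intro s hs
      have hs' : 0 < s := hs
      positivity
    · exact hmono.monovaryOn fun a _ b _ hab => add_le_add_right hab 1
end
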